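/- Let $l, m \ge 1$ and let $a_0, \dots, a_l$ and $b_0, \dots, b_m$ be positive real numbers, each sequence being log-concave, i.e. $a_j^2 \ge a_{j-1} a_{j+1}$ for $1 \le j \le l-1$ and $b_q^2 \ge b_{q-1} b_{q+1}$ for $1 \le q \le m-1$. Define, for $0 \le p \le l+m$, $d_p := \max\{ a_j b_{p-j} : \max(0, p-m) \le j \le \min(p, l) \}$. If $d_p \ne d_{p+1}$ for every $0 \le p \le l+m-1$, then $a_j \ne a_{j+1}$ for every $0 \le j \le l-1$ and $b_q \ne b_{q+1}$ for every $0 \le q \le m-1$. -/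

import Mathlib

theorem flat_is_max (l : ℕ) (a : ℕ → ℝ) (hapos : ∀ j : ℕ, j ≤ l → 0 < a j)
    (halc : ∀ j : ℕ, 1 ≤ j → j + 1 ≤ l → a (j - 1) * a (j + 1) ≤ a j ^ 2)
    (j : ℕ) (hj : j + 1 ≤ l) (h : a j = a (j + 1)) : ∀ i, i ≤ l → a i ≤ a j := by
  have up : ∀ k, j + k + 1 ≤ l → a (j + k + 1) ≤ a (j + k) ∧ a (j + k + 1) ≤ a j := by
    intro k
    induction k with
    | zero => intro _; exact ⟨h.ge, h.ge⟩
    | succ k ih =>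
      intro hk
      obtain ⟨h1, h2⟩ := ih (by omega)
      have h3 := halc (j + k + 1) (by omega) (by omega)
      rw [show j + k + 1 - 1 = j + k by omega] at h3
      have p0 := hapos (j + k) (by omega)
      have p1 := hapos (j + k + 1) (by omega)
      have h4 : a (j + k + 1 + 1) ≤ a (j + k + 1) := by
        refine le_of_mul_le_mul_left ?_ p0
        nlinarith
      exact ⟨h4, h4.trans h2⟩
  have down : ∀ k i, i + k = j → a i ≤ a (i + 1) ∧ a i ≤ a j := by
    intro k
    induction k with
    | zero => intro i hi; obtain rfl : i = j := by omega
              exact ⟨h.le, le_rfl⟩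
    | succ k ih =>
      intro i hi
      obtain ⟨h1, h2⟩ := ih (i + 1) (by omega)
      have h3 := halc (i + 1) (by omega) (by omega)
      rw [show i + 1 - 1 = i by omega] at h3
      have p0 := hapos (i + 1) (by omega)
      have p1 := hapos (i + 1 + 1) (by omega)
      have h4 : a i ≤ a (i + 1) := by
        refine le_of_mul_le_mul_right ?_ p1
        nlinarith
      exact ⟨h4, h4.trans h2⟩
  intro i hi
  rcases Nat.lt_or_ge j i with hc | hc
  · have := (up (i - j - 1) (by omega)).2
    rwa [show j + (i - j - 1) + 1 = i by omega] at this
  · exact (down (j - i) i (by omega)).2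

theorem exists_max (l : ℕ) (a : ℕ → ℝ) : ∃ j, j ≤ l ∧ ∀ i, i ≤ l → a i ≤ a j := by
  obtain ⟨j, hj, h⟩ := Finset.exists_max_image (Finset.range (l + 1)) a ⟨0, by simp⟩
  refine ⟨j, by simpa [Nat.lt_succ_iff] using hj, fun i hi => h i (by simpa [Nat.lt_succ_iff] using hi)⟩

/-- If the max-plus (tropical) convolution of two positive log-concave sequences has
distinct consecutive terms, then so do both of the original sequences. -/
theorem maxConv_distinct_consecutive
    (l m : ℕ) (hl : 1 ≤ l) (hm : 1 ≤ m) (a b : ℕ → ℝ) (d : ℕ → ℝ)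
    (hapos : ∀ j : ℕ, j ≤ l → 0 < a j)
    (hbpos : ∀ q : ℕ, q ≤ m → 0 < b q)
    (halc : ∀ j : ℕ, 1 ≤ j → j + 1 ≤ l → a (j - 1) * a (j + 1) ≤ a j ^ 2)
    (hblc : ∀ q : ℕ, 1 ≤ q → q + 1 ≤ m → b (q - 1) * b (q + 1) ≤ b q ^ 2)
    (hd : ∀ p : ℕ, (hp : p ≤ l + m) →
      d p = (Finset.Icc (p - m) (min p l)).sup'
        (Finset.nonempty_Icc.mpr (by omega)) (fun j => a j * b (p - j)))
    (hdist : ∀ p : ℕ, p + 1 ≤ l + m → d p ≠ d (p + 1)) :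
    (∀ j : ℕ, j + 1 ≤ l → a j ≠ a (j + 1)) ∧
    (∀ q : ℕ, q + 1 ≤ m → b q ≠ b (q + 1)) := by
  have key : ∀ i q, i ≤ l → q ≤ m → (∀ k, k ≤ l → a k ≤ a i) → (∀ k, k ≤ m → b k ≤ b q) →
      d (i + q) = a i * b q := by
    intro i q hi hq ha hb
    rw [hd (i + q) (by omega)]
    apply le_antisymm
    · apply Finset.sup'_le
      intro k hk
      rw [Finset.mem_Icc] at hk
      exact mul_le_mul (ha k (by omega)) (hb _ (by omega)) (hbpos _ (by omega)).le
        (hapos i hi).le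
    · have := Finset.le_sup' (s := Finset.Icc (i + q - m) (min (i + q) l))
        (fun j => a j * b (i + q - j)) (b := i) (Finset.mem_Icc.mpr (by omega))
      simp only [Nat.add_sub_cancel_left] at this
      exact this
  constructor
  · intro j hj h
    have hx := flat_is_max l a hapos halc j hj h
    obtain ⟨q, hq, hb⟩ := exists_max m b
    apply hdist (j + q) (by omega)
    rw [key j q (by omega) hq hx hb, show j + q + 1 = (j + 1) + q by omega,
      key (j + 1) q hj hq (h ▸ hx) hb, h]
  · intro q hq h
    have hx := flat_is_max m b hbpos hblc q hq h
    obtain ⟨j, hj, ha⟩ := exists_max l a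
    apply hdist (j + q) (by omega)
    rw [key j q hj (by omega) ha hx, show j + q + 1 = j + (q + 1) by omega,
      key j (q + 1) hj hq ha (h ▸ hx), h]
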